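/- arXiv:1906.11712 — 3 statements merged into one kernel-verified Lean document; each statement's English description precedes it below -/
import Mathlib

section
/- Let Σ and H be n×n real symmetric positive definite matrices and let t ∈ ℝ. Then, regarding Σ and H as complex matrices, the matrices Σ + itH and Σ − itH are invertible and (Σ + itH)⁻¹ + (Σ − itH)⁻¹ = 2·(Σ + t²·H·Σ⁻¹·H)⁻¹; equivalently, 2·((Σ + itH)⁻¹ + (Σ − itH)⁻¹)⁻¹ equals the (complexification of the) real matrix Σ + t²·H·Σ⁻¹·H. -/
open Matrix

namespace Matrix

variable {ι K : Type*} [Fintype ι] [DecidableEq ι] [Field K]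

/-- The pencil `S ± c • H` factors the Schur-type expression `S - c² • (H * S⁻¹ * H)`. -/
theorem add_smul_mul_mul_sub_smul {S T : Matrix ι ι K} (H : Matrix ι ι K) (c : K)
    (hTS : T * S = 1) :
    (S + c • H) * T * (S - c • H) = S - c ^ 2 • (H * T * H) := by
  have hST : S * T = 1 := mul_eq_one_comm.mp hTS
  simp only [add_mul, mul_sub, smul_mul_assoc, mul_smul_comm, hST, one_mul, mul_assoc H T S, hTS,
    mul_one, smul_add, smul_smul, pow_two]
  abel

/-- If `A * T * B` is invertible, where `T` is inverse to `S` and `A + B = 2 • S`, then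
`A⁻¹ + B⁻¹ = 2 • (A * T * B)⁻¹`. -/
theorem inv_add_inv_eq_two_smul_inv {S T A B : Matrix ι ι K} (hTS : T * S = 1)
    (hAB : A + B = (2 : K) • S) (hA : IsUnit A) (hB : IsUnit B) :
    A⁻¹ + B⁻¹ = (2 : K) • (A * T * B)⁻¹ := by
  have hA' := (isUnit_iff_isUnit_det A).mp hA
  have hB' := (isUnit_iff_isUnit_det B).mp hB
  rw [mul_inv_rev, mul_inv_rev, inv_eq_right_inv hTS, ← mul_smul_comm, ← smul_mul_assoc, ← hAB,
    add_mul, mul_add, mul_nonsing_inv _ hA', mul_one, nonsing_inv_mul_cancel_left _ _ hB', add_comm]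

theorem PosDef.add_sq_smul_mul_inv_mul {S H : Matrix ι ι ℝ} (hS : S.PosDef)
    (hH : H.IsHermitian) (t : ℝ) : (S + t ^ 2 • (H * S⁻¹ * H)).PosDef := by
  refine hS.add_posSemidef (PosSemidef.smul ?_ (sq_nonneg t))
  simpa only [hH.eq] using hS.inv.posSemidef.mul_mul_conjTranspose_same H

end Matrix

/-- For real symmetric positive definite `S` (called Σ in the paper) and `H`,
and `t : ℝ`, the complex matrices `Σ + itH` and `Σ - itH` are invertible, and
`(Σ + itH)⁻¹ + (Σ - itH)⁻¹ = 2 (Σ + t² H Σ⁻¹ H)⁻¹`; equivalently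
`2 ((Σ + itH)⁻¹ + (Σ - itH)⁻¹)⁻¹ = Σ + t² H Σ⁻¹ H` (complexified). -/
theorem stmt_0 (n : ℕ) (hn : 1 ≤ n) (S H : Matrix (Fin n) (Fin n) ℝ)
    (hS : S.PosDef) (hH : H.PosDef) (t : ℝ) :
    IsUnit (S.map Complex.ofReal + (Complex.I * (t : ℂ)) • H.map Complex.ofReal) ∧
    IsUnit (S.map Complex.ofReal - (Complex.I * (t : ℂ)) • H.map Complex.ofReal) ∧
    (S.map Complex.ofReal + (Complex.I * (t : ℂ)) • H.map Complex.ofReal)⁻¹ +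
      (S.map Complex.ofReal - (Complex.I * (t : ℂ)) • H.map Complex.ofReal)⁻¹ =
      (2 : ℂ) • ((S + (t ^ 2) • (H * S⁻¹ * H)).map Complex.ofReal)⁻¹ ∧
    (2 : ℂ) • ((S.map Complex.ofReal + (Complex.I * (t : ℂ)) • H.map Complex.ofReal)⁻¹ +
        (S.map Complex.ofReal - (Complex.I * (t : ℂ)) • H.map Complex.ofReal)⁻¹)⁻¹ =
      (S + (t ^ 2) • (H * S⁻¹ * H)).map Complex.ofReal := by
  have hTS : (S⁻¹).map Complex.ofReal * S.map Complex.ofReal = 1 := by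
    change Complex.ofRealHom.mapMatrix S⁻¹ * Complex.ofRealHom.mapMatrix S = 1
    rw [← map_mul, nonsing_inv_mul _ ((isUnit_iff_isUnit_det S).mp hS.isUnit), map_one]
  have hR : IsUnit ((S + (t ^ 2) • (H * S⁻¹ * H)).map Complex.ofReal) :=
    (hS.add_sq_smul_mul_inv_mul hH.isHermitian t).isUnit.map Complex.ofRealHom.mapMatrix
  have hfac := add_smul_mul_mul_sub_smul (H.map Complex.ofReal) (Complex.I * (t : ℂ)) hTS
  have hmap : S.map Complex.ofReal - (Complex.I * (t : ℂ)) ^ 2 •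
      (H.map Complex.ofReal * (S⁻¹).map Complex.ofReal * H.map Complex.ofReal) =
      (S + (t ^ 2) • (H * S⁻¹ * H)).map Complex.ofReal := by
    have hprod : (H * S⁻¹ * H).map Complex.ofReal =
        H.map Complex.ofReal * (S⁻¹).map Complex.ofReal * H.map Complex.ofReal := by
      change Complex.ofRealHom.mapMatrix (H * S⁻¹ * H) = _
      rw [map_mul, map_mul]
      rfl
    rw [← hprod]
    ext i j
    simp [mul_pow]
  rw [hmap] at hfac
  have hdet := (isUnit_iff_isUnit_det _).mp hR
  rw [← hfac, det_mul, det_mul, IsUnit.mul_iff, IsUnit.mul_iff] at hdet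
  have hA := (isUnit_iff_isUnit_det _).mpr hdet.1.1
  have hB := (isUnit_iff_isUnit_det _).mpr hdet.2
  have hsum := inv_add_inv_eq_two_smul_inv hTS (by rw [two_smul]; abel) hA hB
  rw [hfac] at hsum
  refine ⟨hA, hB, hsum, ?_⟩
  rw [hsum]
  have hinv : ((2 : ℂ) • ((S + (t ^ 2) • (H * S⁻¹ * H)).map Complex.ofReal)⁻¹)⁻¹ =
      (2⁻¹ : ℂ) • (S + (t ^ 2) • (H * S⁻¹ * H)).map Complex.ofReal := by
    apply inv_eq_left_inv
    rw [smul_mul_smul_comm, mul_nonsing_inv _ ((isUnit_iff_isUnit_det _).mp hR),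
      inv_mul_cancel₀ two_ne_zero, one_smul]
  rw [hinv, smul_smul, mul_inv_cancel₀ two_ne_zero, one_smul]
end

section
/- Let Σ and H be n×n real symmetric positive definite matrices and let t ∈ ℝ. Then, over ℂ, (Σ + itH)⁻¹ = (Σ + t²·H·Σ⁻¹·H)⁻¹ − it·(Σ·H⁻¹·Σ + t²·H)⁻¹, where all inverses appearing exist. -/
open Matrix

section Factorization

variable {m R : Type*} [Fintype m] [DecidableEq m] [CommRing R] {A B : Matrix m m R}

lemma mul_inv_mul_add_smul (hA : IsUnit A) (hB : IsUnit B) (c : R) :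
    A * B⁻¹ * A + c • B = A * B⁻¹ * (A + c • (B * A⁻¹ * B)) := by
  rw [isUnit_iff_isUnit_det] at hA hB
  rw [mul_add, Matrix.mul_smul, Matrix.mul_assoc B, Matrix.mul_assoc A,
    Matrix.mul_assoc A B⁻¹ (B * _), nonsing_inv_mul_cancel_left _ _ hB,
    mul_nonsing_inv_cancel_left _ _ hA]

lemma sub_smul_mul_inv_mul_add_smul (hA : IsUnit A) (z : R) :
    (A - z • B) * A⁻¹ * (A + z • B) = A + (-z ^ 2) • (B * A⁻¹ * B) := by
  rw [isUnit_iff_isUnit_det] at hA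
  rw [sub_mul, mul_nonsing_inv _ hA, sub_mul, one_mul, mul_add, Matrix.smul_mul, Matrix.smul_mul,
    nonsing_inv_mul_cancel_right _ _ hA, Matrix.mul_smul, Matrix.smul_mul, smul_smul, ← sq, neg_smul]
  abel

lemma inv_sub_smul_inv_mul_add_smul (hA : IsUnit A) (hB : IsUnit B) {c z : R} (hz : -z ^ 2 = c)
    (hC : IsUnit (A + c • (B * A⁻¹ * B))) :
    ((A + c • (B * A⁻¹ * B))⁻¹ - z • (A * B⁻¹ * A + c • B)⁻¹) * (A + z • B) = 1 := by
  subst hz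
  rw [mul_inv_mul_add_smul hA hB]
  rw [isUnit_iff_isUnit_det] at hB hC
  have hfac : (A + (-z ^ 2) • (B * A⁻¹ * B))⁻¹ * ((A - z • B) * A⁻¹ * (A + z • B)) = 1 := by
    rw [sub_smul_mul_inv_mul_add_smul hA, nonsing_inv_mul _ hC]
  rw [isUnit_iff_isUnit_det] at hA
  rw [← hfac, ← Matrix.mul_assoc, Matrix.mul_inv_rev _ (A + _), Matrix.mul_inv_rev,
    nonsing_inv_nonsing_inv _ hB, sub_mul A, mul_nonsing_inv _ hA, mul_sub, mul_one,
    Matrix.smul_mul, Matrix.mul_smul]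

end Factorization

lemma Matrix.PosDef.isUnit_add_sq_smul {m : Type*} [Fintype m] [DecidableEq m]
    {S H : Matrix m m ℝ} (hS : S.PosDef) (hH : H.IsHermitian) (t : ℝ) :
    IsUnit (S + (t ^ 2) • (H * S⁻¹ * H)) := by
  have h := hS.inv.posSemidef.mul_mul_conjTranspose_same H
  rw [hH.eq] at h
  exact (hS.add_posSemidef (h.smul (sq_nonneg t))).isUnit

/-- For real symmetric positive definite `S` (Σ) and `H` and `t : ℝ`, over ℂ,
`(Σ + itH)⁻¹ = (Σ + t² H Σ⁻¹ H)⁻¹ - it (Σ H⁻¹ Σ + t² H)⁻¹`, and all the inverses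
appearing exist. -/
theorem stmt_1 (n : ℕ) (hn : 1 ≤ n) (S H : Matrix (Fin n) (Fin n) ℝ)
    (hS : S.PosDef) (hH : H.PosDef) (t : ℝ) :
    IsUnit (S.map Complex.ofReal + (Complex.I * (t : ℂ)) • H.map Complex.ofReal) ∧
    IsUnit S ∧ IsUnit H ∧
    IsUnit (S + (t ^ 2) • (H * S⁻¹ * H)) ∧
    IsUnit (S * H⁻¹ * S + (t ^ 2) • H) ∧
    (S.map Complex.ofReal + (Complex.I * (t : ℂ)) • H.map Complex.ofReal)⁻¹ =
      ((S + (t ^ 2) • (H * S⁻¹ * H)).map Complex.ofReal)⁻¹ -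
        (Complex.I * (t : ℂ)) • ((S * H⁻¹ * S + (t ^ 2) • H).map Complex.ofReal)⁻¹ := by
  have hC := hS.isUnit_add_sq_smul hH.isHermitian t
  have hD : IsUnit (S * H⁻¹ * S + (t ^ 2) • H) := by
    rw [mul_inv_mul_add_smul hS.isUnit hH.isUnit]
    exact (hS.isUnit.mul hH.inv.isUnit).mul hC
  let φ : Matrix (Fin n) (Fin n) ℝ →+* Matrix (Fin n) (Fin n) ℂ := Complex.ofRealHom.mapMatrix
  have hφ (M : Matrix (Fin n) (Fin n) ℝ) : M.map Complex.ofReal = φ M := rfl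
  have hsmul (c : ℝ) (M : Matrix (Fin n) (Fin n) ℝ) : φ (c • M) = (c : ℂ) • φ M := by
    ext i j
    simp [φ]
  have hinv {M : Matrix (Fin n) (Fin n) ℝ} (hM : IsUnit M) : φ M⁻¹ = (φ M)⁻¹ := by
    rw [isUnit_iff_isUnit_det] at hM
    refine (inv_eq_left_inv ?_).symm
    rw [← map_mul, nonsing_inv_mul _ hM, map_one]
  have hz : -(Complex.I * (t : ℂ)) ^ 2 = ((t ^ 2 : ℝ) : ℂ) := by
    rw [mul_pow, Complex.I_sq]
    push_cast
    ring
  have hC' := hC.map φ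
  simp only [hφ, map_add, map_mul, hsmul, hinv hS.isUnit, hinv hH.isUnit] at hC' ⊢
  have key := inv_sub_smul_inv_mul_add_smul (hS.isUnit.map φ) (hH.isUnit.map φ) hz hC'
  exact ⟨IsUnit.of_mul_eq_one_right _ key, hS.isUnit, hH.isUnit, hC, hD, inv_eq_left_inv key⟩
end

section
/- Let Σ and H be n×n real symmetric positive definite matrices, let Σ(t) := Σ + t²·H·Σ⁻¹·H, let μ : [0,∞) → ℝⁿ be arbitrary, and for t ≥ 0 let ρ_t := N(·; μ(t), (1/2)·Σ(t)) be the Gaussian density with mean μ(t) and covariance (1/2)·Σ(t). Then the entropy S(t) := −∫_{ℝⁿ} ρ_t(x)·ln ρ_t(x) dx equals n/2 + (n/2)·ln(2π) + (1/2)·ln det((1/2)·Σ(t)) and is a strictly increasing function of t on [0,∞). -/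
open Matrix MeasureTheory

/-- The Gaussian density on ℝⁿ with mean `μ` and covariance matrix `S`:
`N(x; μ, S) = (2π)^{-n/2} (det S)^{-1/2} exp(-(1/2) ⟨x-μ, S⁻¹(x-μ)⟩)`. -/
noncomputable def gaussianDensity (n : ℕ) (μ : Fin n → ℝ)
    (S : Matrix (Fin n) (Fin n) ℝ) (x : Fin n → ℝ) : ℝ :=
  (2 * Real.pi) ^ (-(n : ℝ) / 2) * S.det ^ (-(1 / 2 : ℝ)) *
    Real.exp (-(1 / 2) * ((x - μ) ⬝ᵥ (S⁻¹ *ᵥ (x - μ))))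

/-- The differential entropy of the Gaussian density with (time-dependent) mean `μ t`
and covariance `(1/2) Σ(t)`, where `Σ(t) = Σ + t² H Σ⁻¹ H`. -/
noncomputable def coherentEntropy (n : ℕ) (S H : Matrix (Fin n) (Fin n) ℝ)
    (μ : ℝ → Fin n → ℝ) (t : ℝ) : ℝ :=
  -∫ x : Fin n → ℝ,
      gaussianDensity n (μ t) ((1 / 2 : ℝ) • (S + (t ^ 2) • (H * S⁻¹ * H))) x *
        Real.log (gaussianDensity n (μ t) ((1 / 2 : ℝ) • (S + (t ^ 2) • (H * S⁻¹ * H))) x)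

open ProbabilityTheory

open scoped MatrixOrder Matrix.Norms.L2Operator in
theorem Matrix.PosDef.exists_eq_mul_transpose {ι : Type*} [Fintype ι] [DecidableEq ι]
    {A : Matrix ι ι ℝ} (hA : A.PosDef) : ∃ M : Matrix ι ι ℝ, IsUnit M ∧ A = M * Mᵀ := by
  obtain ⟨M, hM, rfl⟩ :=
    CStarAlgebra.isStrictlyPositive_iff_eq_mul_star_self.mp hA.isStrictlyPositive
  exact ⟨M, hM, by rw [star_eq_conjTranspose, conjTranspose_eq_transpose_of_trivial]⟩

theorem Matrix.PosDef.one_lt_det_one_add {ι : Type*} [Fintype ι] [DecidableEq ι] [Nonempty ι]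
    {C : Matrix ι ι ℝ} (hC : C.PosDef) : 1 < (1 + C).det := by
  have h := Matrix.eval_charpoly C (-1)
  rw [hC.1.charpoly_eq, Polynomial.eval_prod] at h
  have h_neg : scalar ι (-1 : ℝ) - C = -(1 + C) := by
    rw [map_neg, map_one]; abel
  rw [h_neg, det_neg] at h
  have h_prod : (1 + C).det = ∏ i, (1 + hC.1.eigenvalues i) := by
    have h_eval : ∏ i, Polynomial.eval (-1) (Polynomial.X - Polynomial.C (hC.1.eigenvalues i))
        = (-1) ^ Fintype.card ι * ∏ i, (1 + hC.1.eigenvalues i) := by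
      rw [← Finset.card_univ, ← Finset.prod_const, ← Finset.prod_mul_distrib]
      exact Finset.prod_congr rfl fun i _ ↦ by simp; ring
    exact mul_left_cancel₀ (pow_ne_zero _ (by norm_num)) (h.symm.trans h_eval)
  rw [h_prod]
  calc (1 : ℝ) = ∏ _i : ι, (1 : ℝ) := by simp
    _ < _ := Finset.prod_lt_prod_of_nonempty (fun _ _ ↦ one_pos)
      (fun i _ ↦ lt_add_of_pos_right _ (hC.eigenvalues_pos i)) Finset.univ_nonempty

theorem Matrix.PosDef.det_lt_det_add {ι : Type*} [Fintype ι] [DecidableEq ι] [Nonempty ι]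
    {A B : Matrix ι ι ℝ} (hA : A.PosDef) (hB : B.PosDef) : A.det < (A + B).det := by
  obtain ⟨M, hM, rfl⟩ := hA.exists_eq_mul_transpose
  have hM_det : IsUnit M.det := (isUnit_iff_isUnit_det M).mp hM
  have hC : (M⁻¹ * B * (M⁻¹)ᵀ).PosDef := by
    rw [← conjTranspose_eq_transpose_of_trivial]
    exact hB.mul_mul_conjTranspose_same
      (vecMul_injective_iff_isUnit.mpr ((isUnit_nonsing_inv_iff).mpr hM))
  have h_add : M * Mᵀ + B = M * (1 + M⁻¹ * B * (M⁻¹)ᵀ) * Mᵀ := by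
    have hT : (M⁻¹)ᵀ * Mᵀ = 1 := by
      rw [← transpose_mul, mul_nonsing_inv _ hM_det, transpose_one]
    rw [mul_add, add_mul, mul_one, mul_assoc M (_ * _) Mᵀ, mul_assoc (M⁻¹ * B), hT, mul_one,
      ← mul_assoc, mul_nonsing_inv _ hM_det, one_mul]
  rw [h_add, det_mul, det_mul, det_mul, det_transpose]
  nlinarith [hC.one_lt_det_one_add, mul_self_pos.mpr hM_det.ne_zero]

theorem integral_gaussianPDFReal_mul_sq :
    ∫ y, gaussianPDFReal 0 1 y * y ^ 2 = 1 := by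
  have h := variance_fun_id_gaussianReal (μ := 0) (v := 1)
  rw [variance_eq_integral measurable_id'.aemeasurable, integral_id_gaussianReal,
    integral_gaussianReal_eq_integral_smul one_ne_zero] at h
  simpa using h

theorem integral_prod_gaussianPDFReal_mul_sq {ι : Type*} [Fintype ι] [DecidableEq ι] (i : ι) :
    ∫ y : ι → ℝ, (∏ j, gaussianPDFReal 0 1 (y j)) * y i ^ 2 = 1 := by
  have h (y : ι → ℝ) : (∏ j, gaussianPDFReal 0 1 (y j)) * y i ^ 2 =
      ∏ j, gaussianPDFReal 0 1 (y j) * (if j = i then y j ^ 2 else 1) := by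
    rw [Finset.prod_mul_distrib]; simp
  simp_rw [h]
  rw [integral_fintype_prod_volume_eq_prod
    (fun j y ↦ gaussianPDFReal 0 1 y * (if j = i then y ^ 2 else 1))]
  refine Finset.prod_eq_one fun j _ ↦ ?_
  split_ifs
  · exact integral_gaussianPDFReal_mul_sq
  · simpa using integral_gaussianPDFReal_eq_one 0 one_ne_zero

theorem integral_prod_gaussianPDFReal {ι : Type*} [Fintype ι] :
    ∫ y : ι → ℝ, ∏ j, gaussianPDFReal 0 1 (y j) = 1 := by
  rw [integral_fintype_prod_volume_eq_pow, integral_gaussianPDFReal_eq_one 0 one_ne_zero, one_pow]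

theorem integral_prod_gaussianPDFReal_mul_add_sum_sq {ι : Type*} [Fintype ι] (a b : ℝ) :
    ∫ y : ι → ℝ, (∏ j, gaussianPDFReal 0 1 (y j)) * (a + b * ∑ i, y i ^ 2) =
      a + b * Fintype.card ι := by
  classical
  have h_int : Integrable fun y : ι → ℝ ↦ ∏ j, gaussianPDFReal 0 1 (y j) :=
    .of_integral_ne_zero (by rw [integral_prod_gaussianPDFReal]; exact one_ne_zero)
  have h_int_sq (i : ι) :
      Integrable fun y : ι → ℝ ↦ (∏ j, gaussianPDFReal 0 1 (y j)) * y i ^ 2 :=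
    .of_integral_ne_zero (by rw [integral_prod_gaussianPDFReal_mul_sq]; exact one_ne_zero)
  have h (y : ι → ℝ) : (∏ j, gaussianPDFReal 0 1 (y j)) * (a + b * ∑ i, y i ^ 2) =
      a * (∏ j, gaussianPDFReal 0 1 (y j)) +
        b * ∑ i, (∏ j, gaussianPDFReal 0 1 (y j)) * y i ^ 2 := by
    rw [← Finset.mul_sum]; ring
  simp_rw [h]
  rw [integral_add (h_int.const_mul a) ((integrable_finsetSum _ fun i _ ↦ h_int_sq i).const_mul b),
    integral_const_mul, integral_const_mul, integral_finsetSum _ fun i _ ↦ h_int_sq i,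
    integral_prod_gaussianPDFReal]
  simp [integral_prod_gaussianPDFReal_mul_sq]

theorem integral_comp_add_mulVec {ι : Type*} [Fintype ι] [DecidableEq ι] {M : Matrix ι ι ℝ}
    (hM : IsUnit M) (v : ι → ℝ) (f : (ι → ℝ) → ℝ) :
    ∫ y, f (v + M *ᵥ y) = |M.det|⁻¹ * ∫ x, f x := by
  have hM_det : M.det ≠ 0 := ((isUnit_iff_isUnit_det M).mp hM).ne_zero
  have h_emb : MeasurableEmbedding (toLin' M) :=
    (LinearMap.isClosedEmbedding_of_injective (LinearMap.ker_eq_bot.mpr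
      (mulVec_injective_iff_isUnit.mpr hM))).measurableEmbedding
  calc ∫ y, f (v + M *ᵥ y) = ∫ y, f (v + toLin' M y) := by simp
    _ = ∫ x, f (v + x) ∂(Measure.map (toLin' M) volume) :=
      (h_emb.integral_map fun x ↦ f (v + x)).symm
    _ = |M.det|⁻¹ * ∫ x, f x := by
      rw [Real.map_matrix_volume_pi_eq_smul_volume_pi hM_det, integral_smul_measure,
        integral_add_left_eq_self f v, ENNReal.toReal_ofReal (abs_nonneg _), abs_inv, smul_eq_mul]

theorem gaussianDensity_add_mulVec {n : ℕ} {M : Matrix (Fin n) (Fin n) ℝ} (hM : IsUnit M)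
    (v y : Fin n → ℝ) :
    gaussianDensity n v (M * Mᵀ) (v + M *ᵥ y) =
      |M.det|⁻¹ * ∏ i, gaussianPDFReal 0 1 (y i) := by
  have hM_det : IsUnit M.det := (isUnit_iff_isUnit_det M).mp hM
  have h_quad : (M *ᵥ y) ⬝ᵥ ((M * Mᵀ)⁻¹ *ᵥ (M *ᵥ y)) = ∑ i, y i ^ 2 := by
    rw [Matrix.mul_inv_rev, ← mulVec_mulVec, mulVec_mulVec y, nonsing_inv_mul _ hM_det, one_mulVec,
      dotProduct_mulVec, ← transpose_nonsing_inv, vecMul_transpose, mulVec_mulVec,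
      nonsing_inv_mul _ hM_det, one_mulVec]
    simp [dotProduct, sq]
  have h_det : (M * Mᵀ).det ^ (-(1 / 2 : ℝ)) = |M.det|⁻¹ := by
    rw [det_mul, det_transpose, Real.rpow_neg (mul_self_nonneg _), ← Real.sqrt_eq_rpow,
      Real.sqrt_mul_self_eq_abs]
  have h_pi : (2 * Real.pi) ^ (-(n : ℝ) / 2) = (√(2 * Real.pi))⁻¹ ^ n := by
    rw [← Real.rpow_natCast, Real.sqrt_eq_rpow, ← Real.rpow_neg (by positivity),
      ← Real.rpow_mul (by positivity)]
    ring_nf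
  have h_pdf (x : ℝ) : gaussianPDFReal 0 1 x =
      (√(2 * Real.pi))⁻¹ * Real.exp (-(1 / 2) * x ^ 2) := by
    rw [gaussianPDFReal]
    simp only [NNReal.coe_one, mul_one, sub_zero]
    ring_nf
  simp_rw [gaussianDensity, add_sub_cancel_left, h_quad, h_det, h_pi, h_pdf]
  rw [Finset.prod_mul_distrib, ← Real.exp_sum, Finset.mul_sum]
  simp
  ring

theorem log_prod_gaussianPDFReal {ι : Type*} [Fintype ι] (y : ι → ℝ) :
    Real.log (∏ i, gaussianPDFReal 0 1 (y i)) =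
      -(Fintype.card ι / 2 * Real.log (2 * Real.pi)) + -(1 / 2) * ∑ i, y i ^ 2 := by
  have h (x : ℝ) : Real.log (gaussianPDFReal 0 1 x) =
      -(1 / 2 * Real.log (2 * Real.pi)) + -(1 / 2) * x ^ 2 := by
    rw [gaussianPDFReal, Real.log_mul (by positivity) (Real.exp_ne_zero _), Real.log_exp,
      Real.log_inv, Real.log_sqrt (by positivity)]
    simp only [NNReal.coe_one, mul_one, sub_zero]
    ring
  rw [Real.log_prod fun i _ ↦ (gaussianPDFReal_pos 0 1 (y i) one_ne_zero).ne']
  simp_rw [h]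
  rw [Finset.sum_add_distrib, ← Finset.mul_sum]
  simp
  ring

theorem neg_integral_gaussianDensity_mul_log {n : ℕ} (v : Fin n → ℝ)
    {A : Matrix (Fin n) (Fin n) ℝ} (hA : A.PosDef) :
    -∫ x, gaussianDensity n v A x * Real.log (gaussianDensity n v A x) =
      (n : ℝ) / 2 + (n : ℝ) / 2 * Real.log (2 * Real.pi) + 1 / 2 * Real.log A.det := by
  obtain ⟨M, hM, rfl⟩ := hA.exists_eq_mul_transpose
  have hM_det : 0 < |M.det| := abs_pos.mpr ((isUnit_iff_isUnit_det M).mp hM).ne_zero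
  have h := integral_comp_add_mulVec hM v
    fun x ↦ gaussianDensity n v (M * Mᵀ) x * Real.log (gaussianDensity n v (M * Mᵀ) x)
  have h_eq (y : Fin n → ℝ) : gaussianDensity n v (M * Mᵀ) (v + M *ᵥ y) *
        Real.log (gaussianDensity n v (M * Mᵀ) (v + M *ᵥ y)) =
      |M.det|⁻¹ * ((∏ i, gaussianPDFReal 0 1 (y i)) *
        ((-Real.log |M.det| - n / 2 * Real.log (2 * Real.pi)) + -(1 / 2) * ∑ i, y i ^ 2)) := by
    rw [gaussianDensity_add_mulVec hM, Real.log_mul (inv_pos.mpr hM_det).ne'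
      (Finset.prod_pos fun i _ ↦ gaussianPDFReal_pos 0 1 (y i) one_ne_zero).ne', Real.log_inv,
      log_prod_gaussianPDFReal, Fintype.card_fin]
    ring
  simp_rw [h_eq] at h
  rw [integral_const_mul, integral_prod_gaussianPDFReal_mul_add_sum_sq, Fintype.card_fin] at h
  rw [← mul_left_cancel₀ (inv_pos.mpr hM_det).ne' h, det_mul, det_transpose, ← abs_mul_abs_self,
    Real.log_mul hM_det.ne' hM_det.ne']
  ring

/-- the position entropy of the evolving coherent state, a Gaussian with
covariance `(1/2) Σ(t)`, equals `n/2 + (n/2) ln(2π) + (1/2) ln det((1/2) Σ(t))` and is a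
strictly increasing function of `t` on `[0, ∞)`. -/
theorem stmt_8 (n : ℕ) (hn : 1 ≤ n) (S H : Matrix (Fin n) (Fin n) ℝ)
    (hS : S.PosDef) (hH : H.PosDef) (μ : ℝ → Fin n → ℝ) :
    (∀ t : ℝ, 0 ≤ t →
      coherentEntropy n S H μ t =
        (n : ℝ) / 2 + (n : ℝ) / 2 * Real.log (2 * Real.pi) +
          1 / 2 * Real.log ((1 / 2 : ℝ) • (S + (t ^ 2) • (H * S⁻¹ * H))).det) ∧
    StrictMonoOn (coherentEntropy n S H μ) (Set.Ici 0) := by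
  have hK : (H * S⁻¹ * H).PosDef := by
    have h := hS.inv.mul_mul_conjTranspose_same (B := H)
      (vecMul_injective_iff_isUnit.mpr hH.isUnit)
    rwa [hH.isHermitian.eq] at h
  have hA (t : ℝ) : ((1 / 2 : ℝ) • (S + (t ^ 2) • (H * S⁻¹ * H))).PosDef :=
    (hS.add_posSemidef (hK.posSemidef.smul (sq_nonneg t))).smul (by norm_num)
  have h_entropy (t : ℝ) := neg_integral_gaussianDensity_mul_log (μ t) (hA t)
  refine ⟨fun t _ ↦ h_entropy t, fun s hs t _ hst ↦ ?_⟩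
  have : Nonempty (Fin n) := ⟨⟨0, hn⟩⟩
  have h_sq : 0 < t ^ 2 - s ^ 2 := sub_pos.mpr (pow_lt_pow_left₀ hst hs two_ne_zero)
  have h_det := (hA s).det_lt_det_add (hK.smul (half_pos h_sq))
  have h_add : (1 / 2 : ℝ) • (S + (s ^ 2) • (H * S⁻¹ * H)) +
      ((t ^ 2 - s ^ 2) / 2) • (H * S⁻¹ * H) = (1 / 2 : ℝ) • (S + (t ^ 2) • (H * S⁻¹ * H)) := by
    module
  rw [h_add] at h_det
  rw [coherentEntropy, coherentEntropy, h_entropy, h_entropy]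
  gcongr
  exact (hA s).det_pos
end
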